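/- (Expected logarithm of a Dirichlet coordinate) For every class k : Fin K, ∫_T dirα(x) · log(π(x) k) dx = ψ(α k) − ψ(α₀), where ψ(t) = deriv (fun s => Real.log (Real.Gamma s)) t is the digamma function. -/

import Mathlib

open MeasureTheory

/-- The open parameter domain of the probability simplex over `K` outcomes:
vectors of the first `K-1` coordinates, all positive, summing to less than 1. -/
def simplexT (K : ℕ) : Set (Fin (K - 1) → ℝ) :=
  {x | (∀ i, 0 < x i) ∧ ∑ i, x i < 1}

/-- The point of the probability simplex over `K` outcomes determined by its
first `K-1` coordinates: `π(x) i = x i` for `i < K-1` and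
`π(x) (K-1) = 1 - ∑ᵢ x i`. -/
noncomputable def simplexCoord (K : ℕ) (x : Fin (K - 1) → ℝ) (i : Fin K) : ℝ :=
  if h : (i : ℕ) < K - 1 then x ⟨i, h⟩ else 1 - ∑ m, x m

/-- The Dirichlet density with parameter `α`, in the simplex parametrization. -/
noncomputable def dirDensity (K : ℕ) (α : Fin K → ℝ) (x : Fin (K - 1) → ℝ) : ℝ :=
  (Real.Gamma (∑ k, α k) / ∏ k, Real.Gamma (α k)) *
    ∏ k, simplexCoord K x k ^ (α k - 1)

open Set in
/-- The beta integral over `(0, s)`. -/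
theorem lintegral_Ioo_rpow_mul_sub_rpow {a b s : ℝ} (ha : 0 < a) (hb : 0 < b) (hs : 0 < s) :
    ∫⁻ x in Ioo 0 s, ENNReal.ofReal (x ^ (a - 1) * (s - x) ^ (b - 1)) =
      ENNReal.ofReal (ProbabilityTheory.beta a b * s ^ (a + b - 1)) := by
  have hB := ProbabilityTheory.beta_pos ha hb
  have h1 := ProbabilityTheory.lintegral_betaPDF_eq_one ha hb
  rw [ProbabilityTheory.lintegral_betaPDF] at h1
  have himg : Ioo 0 s = (s * ·) '' Ioo 0 1 := by
    rw [image_mul_left_Ioo hs]; simp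
  rw [himg, lintegral_image_eq_lintegral_abs_deriv_mul (f' := fun _ => s) measurableSet_Ioo
    (fun x _ => by simpa using ((hasDerivAt_id x).const_mul s).hasDerivWithinAt)
    (mul_right_injective₀ hs.ne').injOn]
  have h2 : ∀ x ∈ Ioo (0 : ℝ) 1,
      ENNReal.ofReal |s| * ENNReal.ofReal ((s * x) ^ (a - 1) * (s - s * x) ^ (b - 1)) =
      ENNReal.ofReal (ProbabilityTheory.beta a b * s ^ (a + b - 1)) *
        ENNReal.ofReal (1 / ProbabilityTheory.beta a b * x ^ (a - 1) * (1 - x) ^ (b - 1)) := by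
    intro x hx
    rw [← ENNReal.ofReal_mul (abs_nonneg s), ← ENNReal.ofReal_mul (by positivity), abs_of_pos hs,
      show s - s * x = s * (1 - x) by ring, Real.mul_rpow hs.le hx.1.le,
      Real.mul_rpow hs.le (sub_nonneg.2 hx.2.le),
      show a + b - 1 = 1 + (a - 1) + (b - 1) by ring, Real.rpow_add hs, Real.rpow_add hs,
      Real.rpow_one]
    congr 1
    field_simp
  rw [setLIntegral_congr_fun measurableSet_Ioo h2,
    lintegral_const_mul' _ _ ENNReal.ofReal_ne_top, h1, mul_one]

/-- The open corner simplex of size `s`. -/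
def openCorner (n : ℕ) (s : ℝ) : Set (Fin n → ℝ) :=
  {x | (∀ i, 0 < x i) ∧ ∑ i, x i < s}

theorem measurableSet_openCorner (n : ℕ) (s : ℝ) : MeasurableSet (openCorner n s) := by
  unfold openCorner
  measurability

theorem cons_mem_openCorner {n : ℕ} {s u : ℝ} {y : Fin n → ℝ} :
    (Fin.cons u y : Fin (n + 1) → ℝ) ∈ openCorner (n + 1) s ↔ 0 < u ∧ y ∈ openCorner n (s - u) := by
  simp [openCorner, Fin.forall_fin_succ, Fin.sum_univ_succ, and_assoc, lt_sub_iff_add_lt']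

theorem openCorner_eq_empty {n : ℕ} {s : ℝ} (hs : s ≤ 0) : openCorner n s = ∅ := by
  ext x
  simp only [openCorner, Set.mem_ofPred_eq, Set.mem_empty_iff_false, iff_false, not_and, not_lt]
  exact fun h => hs.trans (Finset.sum_nonneg fun i _ => (h i).le)

/-- The Dirichlet integral over the open corner simplex of size `s`. -/
theorem setLIntegral_openCorner_prod_rpow (n : ℕ) (a : Fin n → ℝ) (ha : ∀ i, 0 < a i) {b : ℝ}
    (hb : 0 < b) {s : ℝ} (hs : 0 < s) :
    ∫⁻ x in openCorner n s,
        ENNReal.ofReal ((∏ i, x i ^ (a i - 1)) * (s - ∑ i, x i) ^ (b - 1)) =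
      ENNReal.ofReal ((∏ i, Real.Gamma (a i)) * Real.Gamma b / Real.Gamma (∑ i, a i + b) *
        s ^ (∑ i, a i + b - 1)) := by
  induction n generalizing s with
  | zero =>
    have : openCorner 0 s = Set.univ := by
      ext; simp [openCorner, hs]
    simp [this, lintegral_unique, (Real.Gamma_pos_of_pos hb).ne', volume_pi]
  | succ n ih =>
    have hA : 0 < ∑ i : Fin n, a i.succ + b :=
      add_pos_of_nonneg_of_pos (Finset.sum_nonneg fun i _ => (ha _).le) hb
    set C : ℝ := (∏ i : Fin n, Real.Gamma (a i.succ)) * Real.Gamma b /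
      Real.Gamma (∑ i : Fin n, a i.succ + b) with hC
    have hC0 : 0 ≤ C := by
      have := Real.Gamma_pos_of_pos hA
      have := Real.Gamma_pos_of_pos hb
      have := Finset.prod_nonneg fun (i : Fin n) (_ : i ∈ Finset.univ) =>
        (Real.Gamma_pos_of_pos (ha i.succ)).le
      positivity
    rw [← lintegral_indicator (measurableSet_openCorner _ _),
      ← ((volume_preserving_piFinSuccAbove (fun _ : Fin (n + 1) => ℝ) 0).symm).lintegral_comp_emb
        (MeasurableEquiv.measurableEmbedding _), Measure.volume_eq_prod, lintegral_prod]
    swap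
    · exact (Measurable.comp (Measurable.indicator (by fun_prop) (measurableSet_openCorner _ _))
        (MeasurableEquiv.piFinSuccAbove (fun _ : Fin (n + 1) => ℝ) 0).symm.measurable).aemeasurable
    have hinner : ∀ u : ℝ, ∫⁻ y : Fin n → ℝ, (openCorner (n + 1) s).indicator
          (fun x => ENNReal.ofReal ((∏ i, x i ^ (a i - 1)) * (s - ∑ i, x i) ^ (b - 1)))
          ((MeasurableEquiv.piFinSuccAbove (fun _ : Fin (n + 1) => ℝ) 0).symm (u, y)) =
        (Set.Ioo 0 s).indicator (fun u => ENNReal.ofReal C * ENNReal.ofReal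
          (u ^ (a 0 - 1) * (s - u) ^ (∑ i : Fin n, a i.succ + b - 1))) u := by
      intro u
      have hcons : ∀ y : Fin n → ℝ,
          (MeasurableEquiv.piFinSuccAbove (fun _ : Fin (n + 1) => ℝ) 0).symm (u, y) =
            Fin.cons u y := fun y => by
        simp [MeasurableEquiv.piFinSuccAbove, Fin.insertNthEquiv]
      simp_rw [hcons]
      by_cases hu : u ∈ Set.Ioo 0 s
      · rw [Set.indicator_of_mem hu]
        have hpt : ∀ y : Fin n → ℝ, (openCorner (n + 1) s).indicator
            (fun x => ENNReal.ofReal ((∏ i, x i ^ (a i - 1)) * (s - ∑ i, x i) ^ (b - 1)))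
            (Fin.cons u y : Fin (n + 1) → ℝ) =
            ENNReal.ofReal (u ^ (a 0 - 1)) * (openCorner n (s - u)).indicator (fun y =>
              ENNReal.ofReal ((∏ i, y i ^ (a i.succ - 1)) *
                ((s - u) - ∑ i, y i) ^ (b - 1))) y := by
          intro y
          by_cases hy : y ∈ openCorner n (s - u)
          · rw [Set.indicator_of_mem hy, Set.indicator_of_mem (cons_mem_openCorner.2 ⟨hu.1, hy⟩),
              ← ENNReal.ofReal_mul (Real.rpow_nonneg hu.1.le _)]
            simp [Fin.prod_univ_succ, Fin.sum_univ_succ, mul_assoc, sub_sub]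
          · rw [Set.indicator_of_notMem hy,
              Set.indicator_of_notMem (fun h => hy (cons_mem_openCorner.1 h).2), mul_zero]
        simp_rw [hpt]
        rw [lintegral_const_mul' _ _ ENNReal.ofReal_ne_top,
          lintegral_indicator (measurableSet_openCorner _ _),
          ih _ (fun i => ha i.succ) (sub_pos.2 hu.2), ← hC,
          ← ENNReal.ofReal_mul (Real.rpow_nonneg hu.1.le _), ← ENNReal.ofReal_mul hC0]
        congr 1
        ring
      · rw [Set.indicator_of_notMem hu]
        refine (lintegral_congr fun y => Set.indicator_of_notMem (fun h => hu ?_) _).trans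
          lintegral_zero
        obtain ⟨h0, h1⟩ := cons_mem_openCorner.1 h
        refine ⟨h0, not_le.1 fun hle => ?_⟩
        simp [openCorner_eq_empty (sub_nonpos.2 hle)] at h1
    simp_rw [hinner]
    rw [lintegral_indicator measurableSet_Ioo, lintegral_const_mul' _ _ ENNReal.ofReal_ne_top,
      lintegral_Ioo_rpow_mul_sub_rpow (ha 0) hA hs, ← ENNReal.ofReal_mul hC0, hC,
      ProbabilityTheory.beta, Fin.prod_univ_succ, Fin.sum_univ_succ]
    have := (Real.Gamma_pos_of_pos hA).ne'
    rw [add_assoc (a 0)]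
    congr 1
    field_simp

theorem simplexCoord_pos {K : ℕ} {x : Fin (K - 1) → ℝ} (hx : x ∈ simplexT K) (i : Fin K) :
    0 < simplexCoord K x i := by
  unfold simplexCoord
  split_ifs
  · exact hx.1 _
  · exact sub_pos.2 hx.2

@[fun_prop]
theorem measurable_simplexCoord (K : ℕ) (i : Fin K) : Measurable fun x => simplexCoord K x i := by
  unfold simplexCoord
  split_ifs <;> fun_prop

theorem measurableSet_simplexT (K : ℕ) : MeasurableSet (simplexT K) :=
  measurableSet_openCorner (K - 1) 1

/-- The Dirichlet integral over the open simplex. -/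
theorem setLIntegral_simplexT_prod_rpow {K : ℕ} (hK : 1 ≤ K) (α : Fin K → ℝ)
    (hα : ∀ k, 0 < α k) :
    ∫⁻ x in simplexT K, ENNReal.ofReal (∏ k, simplexCoord K x k ^ (α k - 1)) =
      ENNReal.ofReal ((∏ k, Real.Gamma (α k)) / Real.Gamma (∑ k, α k)) := by
  obtain ⟨n, rfl⟩ := Nat.exists_eq_add_of_le' hK
  have h := setLIntegral_openCorner_prod_rpow n (fun i => α i.castSucc) (fun i => hα _)
    (hα (Fin.last n)) one_pos
  rw [Fin.prod_univ_castSucc, Fin.sum_univ_castSucc]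
  rw [Real.one_rpow, mul_one] at h
  rw [← h]
  simp only [Fin.prod_univ_castSucc, simplexCoord, Fin.val_castSucc, Fin.val_last,
    Nat.add_sub_cancel, Fin.is_lt, lt_irrefl, dite_true, dite_false]
  rfl

/-- Expected logarithm of a Dirichlet coordinate:
`E[log πₖ] = ψ(αₖ) - ψ(α₀)` where `ψ` is the digamma function. -/
theorem dirichlet_expected_log (K : ℕ) (hK : 2 ≤ K)
    (α : Fin K → ℝ) (hα : ∀ k, 0 < α k) (k : Fin K)
    (ψ : ℝ → ℝ) (hψ : ψ = deriv (fun s => Real.log (Real.Gamma s))) :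
    ∫ x in simplexT K, dirDensity K α x * Real.log (simplexCoord K x k) =
      ψ (α k) - ψ (∑ m, α m) := by
  subst hψ
  have hK1 : 1 ≤ K := by omega
  set w : (Fin (K - 1) → ℝ) → ℝ := fun x => ∏ j, simplexCoord K x j ^ (α j - 1) with hw
  have hw_meas : Measurable w := by fun_prop
  have hw_nonneg : ∀ x ∈ simplexT K, 0 ≤ w x := fun x hx =>
    Finset.prod_nonneg fun j _ => Real.rpow_nonneg (simplexCoord_pos hx j).le _
  set X : (Fin (K - 1) → ℝ) → ℝ := fun x => Real.log (simplexCoord K x k) with hX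
  have hX_meas : Measurable X := by fun_prop
  set μ := (volume.restrict (simplexT K)).withDensity (fun x => ENNReal.ofReal (w x)) with hμ
  have hμ_int : ∀ g : (Fin (K - 1) → ℝ) → ℝ, ∫ x, g x ∂μ = ∫ x in simplexT K, w x * g x := by
    intro g
    rw [hμ, integral_withDensity_eq_integral_toReal_smul (by fun_prop) (by simp)]
    refine setIntegral_congr_fun (measurableSet_simplexT K) fun x hx => ?_
    simp [ENNReal.toReal_ofReal (hw_nonneg x hx)]
  set P := ∏ j ∈ Finset.univ.erase k, Real.Gamma (α j) with hP
  have hP_pos : 0 < P := Finset.prod_pos fun j _ => Real.Gamma_pos_of_pos (hα j)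
  have hα₀ : 0 < ∑ m, α m := Finset.sum_pos (fun m _ => hα m) ⟨k, Finset.mem_univ k⟩
  have hle : α k ≤ ∑ m, α m :=
    Finset.single_le_sum (fun m _ => (hα m).le) (Finset.mem_univ k)
  have hexp : ∀ t, -α k < t → ∫⁻ x, ENNReal.ofReal (Real.exp (t * X x)) ∂μ =
      ENNReal.ofReal (P * Real.Gamma (α k + t) / Real.Gamma (∑ m, α m + t)) := by
    intro t ht
    have h := setLIntegral_simplexT_prod_rpow hK1 (Function.update α k (α k + t)) (by
      intro j
      rcases eq_or_ne j k with rfl | hj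
      · simp; linarith
      · simp [hj, hα j])
    have hsum : ∑ j, Function.update α k (α k + t) j = ∑ m, α m + t := by
      rw [Finset.sum_update_of_mem (Finset.mem_univ k), ← Finset.erase_eq,
        ← Finset.add_sum_erase _ _ (Finset.mem_univ k)]
      ring
    have hprod : ∏ j, Real.Gamma (Function.update α k (α k + t) j) =
        P * Real.Gamma (α k + t) := by
      rw [← Finset.mul_prod_erase _ _ (Finset.mem_univ k), Function.update_self, mul_comm, hP]
      congr 1
      exact Finset.prod_congr rfl fun j hj => by
        rw [Function.update_of_ne (Finset.ne_of_mem_erase hj)]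
    rw [hsum, hprod] at h
    rw [← h, hμ, lintegral_withDensity_eq_lintegral_mul _ (by fun_prop) (by fun_prop)]
    refine setLIntegral_congr_fun (measurableSet_simplexT K) fun x hx => ?_
    have hk := simplexCoord_pos hx k
    simp only [Pi.mul_apply]
    rw [← ENNReal.ofReal_mul (hw_nonneg x hx), hw]
    simp only
    rw [← Finset.mul_prod_erase _ _ (Finset.mem_univ k),
      ← Finset.mul_prod_erase Finset.univ (fun j => _ ^ (Function.update α k (α k + t) j - 1))
        (Finset.mem_univ k), Function.update_self,
      show α k + t - 1 = (α k - 1) + t by ring, Real.rpow_add hk, Real.rpow_def_of_pos hk t,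
      mul_comm t]
    rw [Finset.prod_congr rfl fun j hj => by
      rw [← Function.update_of_ne (Finset.ne_of_mem_erase hj) (α k + t) α]]
    congr 1
    ring
  have hset : Set.Ioi (-α k) ⊆ ProbabilityTheory.integrableExpSet X μ := by
    intro t ht
    refine ⟨by fun_prop, ?_⟩
    rw [hasFiniteIntegral_iff_ofReal (ae_of_all _ fun x => (Real.exp_pos _).le), hexp t ht]
    exact ENNReal.ofReal_lt_top
  have hnhds : Set.Ioi (-α k) ∈ nhds (0 : ℝ) := Ioi_mem_nhds (neg_lt_zero.2 (hα k))
  have hderiv := ProbabilityTheory.deriv_mgf_zero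
    (mem_interior_iff_mem_nhds.2 (Filter.mem_of_superset hnhds hset))
  have hmgf : ProbabilityTheory.mgf X μ =ᶠ[nhds 0]
      fun t => P * Real.Gamma (α k + t) / Real.Gamma (∑ m, α m + t) := by
    filter_upwards [hnhds] with t ht
    have ht : -α k < t := ht
    have h1 : 0 < Real.Gamma (α k + t) := Real.Gamma_pos_of_pos (by linarith)
    have h2 : 0 < Real.Gamma (∑ m, α m + t) := Real.Gamma_pos_of_pos (by linarith)
    rw [ProbabilityTheory.mgf, integral_eq_lintegral_of_nonneg_ae
      (ae_of_all _ fun x => (Real.exp_pos _).le) (by fun_prop), hexp t ht,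
      ENNReal.toReal_ofReal (by positivity)]
  have hΓ : ∀ s : ℝ, 0 < s → DifferentiableAt ℝ Real.Gamma s := fun s hs =>
    Real.differentiableAt_Gamma fun m => by
      have : (0 : ℝ) ≤ m := m.cast_nonneg
      linarith
  have hψ : ∀ s : ℝ, 0 < s → deriv (fun s => Real.log (Real.Gamma s)) s =
      deriv Real.Gamma s / Real.Gamma s := fun s hs =>
    deriv.log (hΓ s hs) (Real.Gamma_pos_of_pos hs).ne'
  have hshift : ∀ s : ℝ, 0 < s →
      HasDerivAt (fun t => Real.Gamma (s + t)) (deriv Real.Gamma s) 0 := fun s hs => by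
    have := (hΓ s hs).hasDerivAt
    rw [← add_zero s] at this
    simpa using this.comp_const_add s 0
  have hG1 := Real.Gamma_pos_of_pos (hα k)
  have hG2 := Real.Gamma_pos_of_pos hα₀
  have hquot : deriv (fun t => P * Real.Gamma (α k + t) / Real.Gamma (∑ m, α m + t)) 0 = _ :=
    (((hshift _ (hα k)).const_mul P).div (hshift _ hα₀) (by simpa using hG2.ne')).deriv
  rw [hmgf.deriv_eq, hquot, hμ_int] at hderiv
  have hint : ∫ x in simplexT K, dirDensity K α x * Real.log (simplexCoord K x k) =
      (Real.Gamma (∑ m, α m) / ∏ j, Real.Gamma (α j)) * ∫ x in simplexT K, w x * X x := by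
    rw [← integral_const_mul]
    simp only [dirDensity, hw, hX, mul_assoc]
  rw [hint, ← hderiv, hψ _ (hα k), hψ _ hα₀, ← Finset.mul_prod_erase _ _ (Finset.mem_univ k), ← hP]
  simp only [add_zero]
  field_simp
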